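/- Let n ≥ 4 and let σ ∈ S_n be an odd permutation (sign σ = −1) whose cycle type is not (n−2,2), i.e. cycleType σ ≠ {n−2, 2}. Then the multiplicity of −1 as a root of P_σ(X) is strictly greater than the multiplicity of −1 as a root of m_σ(X). Equivalently, σ has −1 as an eigenvalue on the Specht module S^{(n−2,2)}, whose characteristic polynomial at σ is the cofactor P_σ/m_σ. -/

import Mathlib

open Polynomial

noncomputable section

/-- `m_σ(X)`: the characteristic polynomial of the `n × n` permutation matrix of `σ` over `ℂ`
(the action on the permutation module `M^{(n-1,1)} = ℂ^n`). -/
def mPoly {n : ℕ} (σ : Equiv.Perm (Fin n)) : ℂ[X] :=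
  (σ.permMatrix ℂ).charpoly

/-- The permutation induced by `σ` on the set of 2-element subsets of `{1, …, n}`. -/
def pairsPerm {n : ℕ} (σ : Equiv.Perm (Fin n)) :
    Equiv.Perm {s : Finset (Fin n) // s.card = 2} :=
  Equiv.Perm.subtypePerm (Equiv.finsetCongr σ) fun s => by
    simp [Equiv.finsetCongr_apply, Finset.card_map]

/-- `P_σ(X)`: the characteristic polynomial of the permutation matrix over `ℂ` of the
permutation induced by `σ` on 2-element subsets (the action on `M^{(n-2,2)}`). -/
def PPoly {n : ℕ} (σ : Equiv.Perm (Fin n)) : ℂ[X] :=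
  ((pairsPerm σ).permMatrix ℂ).charpoly

end

section Charpoly

variable {K V W : Type*} [Field K] [AddCommGroup V] [Module K V] [FiniteDimensional K V]
  [AddCommGroup W] [Module K W] [FiniteDimensional K W]

open Module.Basis in
/-- The characteristic polynomial is multiplicative along an invariant subspace. -/
theorem LinearMap.charpoly_eq_charpoly_restrict_mul_charpoly_mapQ (U : Submodule K V)
    (e : V →ₗ[K] V) (he : U ≤ U.comap e) :
    e.charpoly = (e.restrict he).charpoly * (U.mapQ U e he).charpoly := by
  let bU := Module.Free.chooseBasis K U
  let bQ := Module.Free.chooseBasis K (V ⧸ U)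
  let b := sumQuot bU bQ
  suffices LinearMap.toMatrix b b e = Matrix.fromBlocks (LinearMap.toMatrix bU bU (e.restrict he))
      (Matrix.of fun i l ↦ (b.repr (e (b (Sum.inr l)))) (Sum.inl i)) 0
      (LinearMap.toMatrix bQ bQ (U.mapQ U e he)) by
    rw [← LinearMap.charpoly_toMatrix e b, this, ← LinearMap.charpoly_toMatrix _ bU,
      ← LinearMap.charpoly_toMatrix _ bQ, Matrix.charpoly_fromBlocks_zero₂₁]
  ext u v
  cases u with
  | inl i =>
    cases v with
    | inl k =>
      simp only [b, sumQuot_inl, Matrix.fromBlocks_apply₁₁, LinearMap.toMatrix_apply]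
      apply sumQuot_repr_inl_of_mem
    | inr l => simp [LinearMap.toMatrix_apply, Matrix.fromBlocks_apply₁₂]
  | inr j =>
    cases v with
    | inl k =>
      suffices U.mkQ (e (bU k)) = 0 by simp [LinearMap.toMatrix_apply, b, this]
      rw [← LinearMap.mem_ker, Submodule.ker_mkQ]
      exact he (Submodule.coe_mem (bU k))
    | inr l =>
      simp only [LinearMap.toMatrix_apply, sumQuot_repr_inr, Matrix.fromBlocks_apply₂₂, b]
      rw [← sumQuot_inr bU bQ l, U.mapQ_apply]
      simp

/-- If `A` is an injective map intertwining `T` and `S`, and `S` has an eigenvector outside the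
range of `A`, then its eigenvalue is a root of the cofactor of `T.charpoly` in `S.charpoly`. -/
theorem LinearMap.exists_charpoly_eq_mul_of_intertwining {T : V →ₗ[K] V} {S : W →ₗ[K] W}
    {A : V →ₗ[K] W} (hA : Function.Injective A) (h : ∀ v, S (A v) = A (T v)) {g : W} {μ : K}
    (hg : S g = μ • g) (hgA : g ∉ LinearMap.range A) :
    ∃ q : K[X], S.charpoly = T.charpoly * q ∧ q.IsRoot μ := by
  have he : LinearMap.range A ≤ (LinearMap.range A).comap S := by
    rintro _ ⟨v, rfl⟩
    exact ⟨T v, (h v).symm⟩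
  have hconj : S.restrict he = (LinearEquiv.ofInjective A hA).conj T := by
    ext ⟨_, v, rfl⟩
    have hv : (⟨A v, ⟨v, rfl⟩⟩ : LinearMap.range A) = LinearEquiv.ofInjective A hA v := rfl
    rw [LinearEquiv.conj_apply_apply, hv, LinearEquiv.symm_apply_apply]
    exact h v
  refine ⟨_, (S.charpoly_eq_charpoly_restrict_mul_charpoly_mapQ _ he).trans
    (by rw [hconj, LinearEquiv.charpoly_conj]), ?_⟩
  rw [← Module.End.hasEigenvalue_iff_isRoot_charpoly]
  refine Module.End.hasEigenvalue_of_hasEigenvector (x := (LinearMap.range A).mkQ g) ⟨?_, ?_⟩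
  · rw [Module.End.mem_eigenspace_iff, Submodule.mkQ_apply, Submodule.mapQ_apply, hg,
      Submodule.Quotient.mk_smul]
  · simpa using hgA

end Charpoly

section Perm

open Equiv.Perm

variable {α : Type*} {σ : Equiv.Perm α}

/-- A function changing sign along `σ` and not vanishing on a given cycle of even length. -/
theorem Equiv.Perm.exists_alternating_on_cycle {a : α}
    (ha : ∀ k : ℤ, (σ ^ k) a = a → Even k) :
    ∃ f : α → ℂ, (∀ x, f (σ x) = -f x) ∧ f a = 1 := by
  classical
  let f : α → ℂ := fun x => if h : σ.SameCycle a x then (-1) ^ h.choose else 0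
  have hf (k : ℤ) : f ((σ ^ k) a) = (-1) ^ k := by
    have h : σ.SameCycle a ((σ ^ k) a) := ⟨k, rfl⟩
    have hk : (σ ^ (h.choose - k)) a = a := by
      rw [sub_eq_neg_add, zpow_add, Equiv.Perm.mul_apply, h.choose_spec, zpow_neg,
        inv_eq_iff_eq]
    have hs : (-1 : ℂ) ^ (h.choose - k) = 1 := (ha _ hk).neg_one_zpow
    rw [zpow_sub₀ (by norm_num), div_eq_one_iff_eq (zpow_ne_zero _ (by norm_num))] at hs
    simpa only [f, dif_pos h] using hs
  refine ⟨f, fun x => ?_, by simpa using hf 0⟩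
  by_cases hx : σ.SameCycle a x
  · obtain ⟨k, rfl⟩ := hx
    rw [← Equiv.Perm.mul_apply, ← zpow_one_add, hf, hf, zpow_one_add₀ (by norm_num), neg_one_mul]
  · have hx' : ¬ σ.SameCycle a (σ x) := by rwa [sameCycle_apply_right]
    simp [f, hx, hx']

/-- If a cycle of even length has at least two cycles besides it, some antisymmetric function on
pairs is not a sum of values at the two points. -/
theorem Equiv.Perm.exists_antisymm_of_three_cycles {a b c : α}
    (ha : ∀ k : ℤ, (σ ^ k) a = a → Even k) (hab : ¬ σ.SameCycle a b) (hac : ¬ σ.SameCycle a c)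
    (hbc : ¬ σ.SameCycle b c) :
    ∃ h : α → α → ℂ, (∀ i j, h (σ i) (σ j) = -h i j) ∧
      ¬ ∃ f : α → ℂ, ∀ i j, i ≠ j → f i + f j = h i j + h j i := by
  classical
  obtain ⟨u, hu, hua⟩ := exists_alternating_on_cycle ha
  refine ⟨fun i j => if σ.SameCycle b j then u i else 0, fun i j => ?_, ?_⟩
  · by_cases hj : σ.SameCycle b j <;> simp [sameCycle_apply_right, hj, hu]
  rintro ⟨f, hf⟩
  have hbb : σ.SameCycle b b := .refl _ _
  have hba : ¬ σ.SameCycle b a := fun h => hab h.symm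
  have hne {x y z : α} (hx : σ.SameCycle x y) (hz : ¬ σ.SameCycle x z) : y ≠ z := by
    rintro rfl; exact hz hx
  have haa : σ.SameCycle a a := .refl _ _
  have haa' : σ.SameCycle a (σ a) := sameCycle_apply_right.2 haa
  have hba' : ¬ σ.SameCycle b (σ a) := by rwa [sameCycle_apply_right]
  have h1 := hf a b (hne haa hab)
  have h2 := hf (σ a) b (hne haa' hab)
  have h3 := hf a c (hne haa hac)
  have h4 := hf (σ a) c (hne haa' hac)
  simp [hbb, hba, hba', hbc, hu, hua] at h1 h2 h3 h4
  have : (2 : ℂ) = 0 := by linear_combination h3 - h4 - h1 + h2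
  norm_num at this

/-- If a cycle has even length at least `4`, some antisymmetric function on pairs is not a sum of
values at the two points. -/
theorem Equiv.Perm.exists_antisymm_of_four_le {a : α}
    (ha : ∀ k : ℤ, (σ ^ k) a = a → Even k) (ha2 : (σ ^ 2) a ≠ a) :
    ∃ h : α → α → ℂ, (∀ i j, h (σ i) (σ j) = -h i j) ∧
      ¬ ∃ f : α → ℂ, ∀ i j, i ≠ j → f i + f j = h i j + h j i := by
  classical
  obtain ⟨u, hu, hua⟩ := exists_alternating_on_cycle ha
  refine ⟨fun i j => if j = σ i then u i else 0, fun i j => ?_, ?_⟩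
  · by_cases hj : j = σ i <;> simp [hj, hu]
  rintro ⟨f, hf⟩
  have n1 : σ a ≠ a := fun h => by simpa using ha 1 (by simpa using h)
  have n2 : σ (σ a) ≠ a := ha2
  have n3 : σ (σ (σ a)) ≠ a := fun h => by
    have := ha 3 h
    exact absurd this (by decide)
  have h1 := hf a (σ a) n1.symm
  have h2 := hf (σ (σ a)) (σ (σ (σ a))) (by simpa using n1.symm)
  have h3 := hf a (σ (σ a)) n2.symm
  have h4 := hf (σ a) (σ (σ (σ a))) (by simpa using n2.symm)
  simp [hu, hua, n1, n2.symm, n3.symm] at h1 h2 h3 h4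
  have : (2 : ℂ) = 0 := by linear_combination h3 + h4 - h1 - h2
  norm_num at this

variable [Fintype α] [DecidableEq α]

/-- An odd permutation has a cycle of even length. -/
theorem Equiv.Perm.exists_even_card_support_cycleOf (hσ : sign σ = -1) :
    ∃ a ∈ σ.support, Even (σ.cycleOf a).support.card := by
  obtain ⟨l, hl, hle⟩ : ∃ l ∈ σ.cycleType, Even l := by
    by_contra! h
    have : sign σ = 1 := by
      rw [sign_of_cycleType']
      refine Multiset.prod_eq_one fun x hx => ?_
      obtain ⟨l, hl, rfl⟩ := Multiset.mem_map.1 hx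
      simp [(Nat.not_even_iff_odd.1 (h l hl)).neg_one_pow]
    rw [this] at hσ
    exact absurd hσ (by decide)
  rw [cycleType_def, Multiset.mem_map] at hl
  obtain ⟨c, hc, rfl⟩ := hl
  obtain ⟨a, hac⟩ := (mem_cycleFactorsFinset_iff.1 hc).1.nonempty_support
  refine ⟨a, mem_cycleFactorsFinset_support_le hc hac, ?_⟩
  rwa [← cycle_is_cycleOf hac hc]

/-- A permutation with exactly two nontrivial cycles and no fixed points. -/
theorem Equiv.Perm.cycleType_eq_pair {a b : α} (ha : a ∈ σ.support) (hb : b ∈ σ.support)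
    (hab : ¬ σ.SameCycle a b) (h : ∀ x, ¬ σ.SameCycle a x → σ.SameCycle b x) :
    σ.cycleType = {Fintype.card α - (σ.cycleOf a).support.card, (σ.cycleOf a).support.card} := by
  have hne : σ.cycleOf b ≠ σ.cycleOf a := fun h' =>
    hab ((sameCycle_iff_cycleOf_eq_of_mem_support ha hb).2 h'.symm)
  have hfac : σ.cycleFactorsFinset = {σ.cycleOf b, σ.cycleOf a} := by
    ext c
    simp only [Finset.mem_insert, Finset.mem_singleton]
    constructor
    · intro hc
      obtain ⟨x, hx⟩ := (mem_cycleFactorsFinset_iff.1 hc).1.nonempty_support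
      rw [cycle_is_cycleOf hx hc]
      by_cases hax : σ.SameCycle a x
      · exact .inr hax.cycleOf_eq.symm
      · exact .inl (h x hax).cycleOf_eq.symm
    · rintro (rfl | rfl) <;> rwa [cycleOf_mem_cycleFactorsFinset_iff]
  have hsupp : (σ.cycleOf b).support = (σ.cycleOf a).supportᶜ := by
    ext x
    rw [Finset.mem_compl, mem_support_cycleOf_iff' (mem_support.1 ha),
      mem_support_cycleOf_iff' (mem_support.1 hb)]
    exact ⟨fun hbx hax => hab (hax.trans hbx.symm), h x⟩
  rw [cycleType_def, hfac, Finset.insert_val_of_notMem (by simpa using hne), ← Finset.card_compl,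
    ← hsupp]
  simp

theorem Equiv.Perm.exists_antisymm_of_odd (hn : 4 ≤ Fintype.card α) (hσ : sign σ = -1)
    (hct : σ.cycleType ≠ {Fintype.card α - 2, 2}) :
    ∃ h : α → α → ℂ, (∀ i j, h (σ i) (σ j) = -h i j) ∧
      ¬ ∃ f : α → ℂ, ∀ i j, i ≠ j → f i + f j = h i j + h j i := by
  obtain ⟨a, ha, hev⟩ := exists_even_card_support_cycleOf hσ
  have hmem (x : α) : x ∈ (σ.cycleOf a).support ↔ σ.SameCycle a x :=
    mem_support_cycleOf_iff' (mem_support.1 ha)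
  have hon := isCycleOn_support_cycleOf σ a
  have haa : a ∈ (σ.cycleOf a).support := (hmem a).2 (.refl _ _)
  have hper (k : ℤ) (hk : (σ ^ k) a = a) : Even k := by
    rw [hon.zpow_apply_eq haa] at hk
    exact even_iff_two_dvd.2 ((Int.natCast_dvd_natCast.2 hev.two_dvd).trans hk)
  by_cases h2 : (σ ^ 2) a = a
  · have hcard : (σ.cycleOf a).support.card = 2 := by
      rw [hon.pow_apply_eq haa] at h2
      exact Nat.dvd_antisymm h2 hev.two_dvd
    have hcompl : 1 < ((σ.cycleOf a).supportᶜ).card := by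
      rw [Finset.card_compl, hcard]; omega
    obtain ⟨b, hb, c, hc, hbc⟩ := Finset.one_lt_card.1 hcompl
    rw [Finset.mem_compl, hmem] at hb hc
    by_cases hall : ∀ x, ¬ σ.SameCycle a x → σ.SameCycle b x
    · refine absurd ?_ hct
      have hbs : b ∈ σ.support := by
        rw [mem_support]
        intro hfix
        exact hbc ((hall c hc).eq_of_left hfix)
      rw [cycleType_eq_pair ha hbs hb hall, hcard]
    · push Not at hall
      obtain ⟨d, had, hbd⟩ := hall
      exact exists_antisymm_of_three_cycles hper hb had hbd
  · exact exists_antisymm_of_four_le hper h2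

end Perm

section Pairs

variable {n : ℕ}

theorem pairsPerm_mk (σ : Equiv.Perm (Fin n)) {i j : Fin n} (hij : ({i, j} : Finset _).card = 2)
    (hij' : ({σ i, σ j} : Finset _).card = 2) :
    pairsPerm σ ⟨{i, j}, hij⟩ = ⟨{σ i, σ j}, hij'⟩ := by
  apply Subtype.ext
  simp [pairsPerm, Equiv.finsetCongr_apply, Finset.map_insert]

/-- The embedding of the permutation module on points into the one on pairs. -/
noncomputable def pairSum (n : ℕ) :
    (Fin n → ℂ) →ₗ[ℂ] ({s : Finset (Fin n) // s.card = 2} → ℂ) where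
  toFun f s := ∑ i ∈ s.1, f i
  map_add' f g := by ext s; simp [Finset.sum_add_distrib]
  map_smul' c f := by ext s; simp [Finset.mul_sum]

theorem pairSum_mk (f : Fin n → ℂ) {i j : Fin n} (hij : i ≠ j) :
    pairSum n f ⟨{i, j}, Finset.card_pair hij⟩ = f i + f j :=
  Finset.sum_pair hij

theorem pairSum_comp (σ : Equiv.Perm (Fin n)) (f : Fin n → ℂ) :
    pairSum n f ∘ pairsPerm σ = pairSum n (f ∘ σ) := by
  ext ⟨s, hs⟩
  simp [pairSum, pairsPerm, Equiv.finsetCongr_apply]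

theorem pairSum_injective (hn : 3 ≤ n) : Function.Injective (pairSum n) := by
  rw [injective_iff_map_eq_zero]
  intro f hf
  have hpair (i j : Fin n) (hij : i ≠ j) : f i + f j = 0 := by
    rw [← pairSum_mk f hij, hf]; rfl
  ext i
  obtain ⟨j, hj⟩ : ∃ j, j ∉ ({i} : Finset (Fin n)) := by
    by_contra! h
    have := Finset.card_le_card (fun x _ => h x : Finset.univ ⊆ ({i} : Finset (Fin n)))
    simp at this; omega
  obtain ⟨k, hk⟩ : ∃ k, k ∉ ({i, j} : Finset (Fin n)) := by
    by_contra! h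
    have := (Finset.card_le_card (fun x _ => h x : Finset.univ ⊆ ({i, j} : Finset (Fin n)))).trans
      Finset.card_le_two
    simp at this; omega
  simp only [Finset.mem_insert, Finset.mem_singleton, not_or] at hj hk
  have h1 := hpair j i hj
  have h2 := hpair k i hk.1
  have h3 := hpair k j hk.2
  simp only [Pi.zero_apply]
  linear_combination (h1 + h2 - h3) / 2

/-- The function on pairs obtained by symmetrizing a function of two points. -/
noncomputable def pairLift (h : Fin n → Fin n → ℂ) (s : {s : Finset (Fin n) // s.card = 2}) : ℂ :=
  ∑ p ∈ s.1.offDiag, h p.1 p.2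

theorem pairLift_mk (h : Fin n → Fin n → ℂ) {i j : Fin n} (hij : i ≠ j) :
    pairLift h ⟨{i, j}, Finset.card_pair hij⟩ = h i j + h j i := by
  have : ({i, j} : Finset (Fin n)).offDiag = {(i, j), (j, i)} := by
    ext ⟨x, y⟩
    simp only [Finset.mem_offDiag, Finset.mem_insert, Finset.mem_singleton, Prod.mk.injEq]
    grind
  rw [pairLift, this, Finset.sum_pair (by simp [hij])]

theorem pairLift_comp (σ : Equiv.Perm (Fin n)) {h : Fin n → Fin n → ℂ}
    (hh : ∀ i j, h (σ i) (σ j) = -h i j) : pairLift h ∘ pairsPerm σ = (-1 : ℂ) • pairLift h := by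
  ext ⟨s, hs⟩
  obtain ⟨i, j, hij, rfl⟩ := Finset.card_eq_two.1 hs
  have hij' : σ i ≠ σ j := σ.injective.ne hij
  rw [Function.comp_apply, pairsPerm_mk σ hs (Finset.card_pair hij'), pairLift_mk h hij',
    Pi.smul_apply, pairLift_mk h hij, hh, hh, smul_eq_mul]
  ring

end Pairs

theorem Polynomial.rootMultiplicity_lt_mul {K : Type*} [Field K] {p q : K[X]} {x : K}
    (hpq : p * q ≠ 0) (hq : q.IsRoot x) :
    p.rootMultiplicity x < (p * q).rootMultiplicity x := by
  rw [rootMultiplicity_mul hpq]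
  exact Nat.lt_add_of_pos_right ((rootMultiplicity_pos (right_ne_zero_of_mul hpq)).2 hq)

/-- For `n ≥ 4` and `σ ∈ S_n` an odd permutation whose cycle type is not `(n-2,2)`, the
multiplicity of `-1` as a root of `P_σ(X)` strictly exceeds that of `m_σ(X)`; equivalently,
`σ` has `-1` as an eigenvalue on `S^{(n-2,2)}`, whose characteristic polynomial at `σ` is the
cofactor `P_σ/m_σ`. -/
theorem odd_perm_neg_one_eigenvalue (n : ℕ) (hn : 4 ≤ n) (σ : Equiv.Perm (Fin n))
    (hσ : Equiv.Perm.sign σ = -1) (hct : σ.cycleType ≠ {n - 2, 2}) :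
    (mPoly σ).rootMultiplicity (-1) < (PPoly σ).rootMultiplicity (-1) ∧
    (PPoly σ / mPoly σ).IsRoot (-1) := by
  obtain ⟨h, hh, hnot⟩ := Equiv.Perm.exists_antisymm_of_odd (by simpa using hn) hσ
    (by simpa using hct)
  obtain ⟨q, hq, hroot⟩ := LinearMap.exists_charpoly_eq_mul_of_intertwining
    (T := (σ.permMatrix ℂ).toLin') (S := ((pairsPerm σ).permMatrix ℂ).toLin')
    (pairSum_injective (by omega : 3 ≤ n))
    (fun f => by
      simp only [Matrix.toLin'_apply, Matrix.permMatrix_mulVec, pairSum_comp])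
    (g := pairLift h) (μ := -1)
    (by rw [Matrix.toLin'_apply, Matrix.permMatrix_mulVec, pairLift_comp σ hh])
    (by
      rintro ⟨f, hf⟩
      exact hnot ⟨f, fun i j hij => by rw [← pairSum_mk f hij, hf, pairLift_mk h hij]⟩)
  rw [Matrix.charpoly_toLin', Matrix.charpoly_toLin'] at hq
  change PPoly σ = mPoly σ * q at hq
  have hm : mPoly σ ≠ 0 := (Matrix.charpoly_monic _).ne_zero
  have hP : PPoly σ ≠ 0 := (Matrix.charpoly_monic _).ne_zero
  rw [hq] at hP ⊢
  exact ⟨Polynomial.rootMultiplicity_lt_mul hP hroot, by rwa [mul_div_cancel_left₀ q hm]⟩
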